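/- Let α, ℓ > 0, take α_1 = … = α_d = α, ℓ_1 = … = ℓ_d = ℓ and k_1 = … = k_d = k, and form the product grid X_k × … × X_k from the univariate point sets X_k built with n̄_m = m, so n = #X_k = k(k+1). Assume C > 0 and h₀ ∈ (0,1] are such that for every closed interval Ω ⊂ ℝ of length 1 and every finite X ⊂ ℝ with X ∩ Ω ≠ ∅ and h_{X,Ω} ≤ h₀ one has ∫_Ω P_{ℓ,X}(x) dx ≤ exp(C log(h_{X,Ω}) / h_{X,Ω}), and set h̄₀ = min{h₀, 1/c_qu}. Then there is a positive constant C', depending only on ℓ, α, d, c_qu and C, such that the optimal-weight worst-case error of the product grid satisfies e^{opt}_{α,ℓ}(X_k × … × X_k) ≤ C' exp(−√n/(2√2 α²)) whenever k ≥ 2 c_qu/h̄₀. -/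

import Mathlib

open MeasureTheory Real Filter

noncomputable section

/-- The orthonormal basis functions of the Gaussian RKHS. -/
def phi (ℓ : ℝ) (m : ℕ) (x : ℝ) : ℝ :=
  x ^ m * Real.exp (-x ^ 2 / (2 * ℓ ^ 2)) / (ℓ ^ m * Real.sqrt (Nat.factorial m))

/-- The univariate Gaussian integral functional. -/
def Igauss (α : ℝ) (f : ℝ → ℝ) : ℝ :=
  (Real.sqrt (2 * Real.pi) * α)⁻¹ * ∫ x : ℝ, f x * Real.exp (-x ^ 2 / (2 * α ^ 2))

/-- β = αℓ/√(α² + ℓ²). -/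
def betaP (α ℓ : ℝ) : ℝ := α * ℓ / Real.sqrt (α ^ 2 + ℓ ^ 2)

/-- C_n = 2^n n! n^{−1/4} / √((2n)!). -/
def Cseq (n : ℕ) : ℝ :=
  2 ^ n * (Nat.factorial n : ℝ) * (n : ℝ) ^ (-(1 / 4 : ℝ)) / Real.sqrt (Nat.factorial (2 * n))

/-- ω_γ = 2γ²/(1 + 2γ² + √(1+4γ²)). -/
def omegaP (γ : ℝ) : ℝ := 2 * γ ^ 2 / (1 + 2 * γ ^ 2 + Real.sqrt (1 + 4 * γ ^ 2))

/-- C̄_n(γ). -/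
def Cbar (γ : ℝ) (n : ℕ) : ℝ :=
  Real.sqrt (2 * (1 + 4 * γ ^ 2) ^ ((1 : ℝ) / 4) /
      ((1 + 2 * γ ^ 2 + Real.sqrt (1 + 4 * γ ^ 2)) * Real.exp 1)) *
    ((Nat.factorial n : ℝ) / (Nat.factorial (2 * n) : ℝ)) *
    (Real.exp 1 / (4 * (n : ℝ))) ^ (-(n : ℤ))

/-- `x`, `w` are the nodes and weights of the n-point Gauss–Hermite rule: the nodes are the
n distinct roots of the probabilists' Hermite polynomial H_n, the weights are positive, and
the rule integrates exactly all polynomials of degree at most 2n−1 against the standard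
Gaussian weight. -/
def IsGaussHermite (n : ℕ) (x w : Fin n → ℝ) : Prop :=
  Function.Injective x ∧
  (∀ i, Polynomial.aeval (x i) (Polynomial.hermite n) = 0) ∧
  (∀ i, 0 < w i) ∧
  ∀ p : Polynomial ℝ, p.natDegree ≤ 2 * n - 1 →
    ∑ i, w i * p.eval (x i)
      = (Real.sqrt (2 * Real.pi))⁻¹ * ∫ t : ℝ, p.eval t * Real.exp (-t ^ 2 / 2)

/-- The scaled Gauss–Hermite rule Q_{α,ℓ,n}^{GH}. -/
def QGH (α ℓ : ℝ) {n : ℕ} (x w : Fin n → ℝ) (f : ℝ → ℝ) : ℝ :=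
  betaP α ℓ / α *
    ∑ i, w i * Real.exp (betaP α ℓ ^ 2 * x i ^ 2 / (2 * ℓ ^ 2)) * f (betaP α ℓ * x i)

/-- Membership in the unit ball of the Gaussian RKHS H(K_ℓ). -/
def InBall (ℓ : ℝ) (f : ℝ → ℝ) : Prop :=
  ∃ c : ℕ → ℝ, (∀ x, HasSum (fun m => c m * phi ℓ m x) (f x)) ∧
    Summable (fun m => c m ^ 2) ∧ (∑' m, c m ^ 2) ≤ 1

/-- Worst-case error of a quadrature functional over the unit ball of H(K_ℓ). -/
def wce1 (α ℓ : ℝ) (Q : (ℝ → ℝ) → ℝ) : ℝ :=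
  sSup {e : ℝ | ∃ f : ℝ → ℝ, InBall ℓ f ∧ e = |Igauss α f - Q f|}

/-- The n-th minimal worst-case error (univariate). -/
def minErr1 (α ℓ : ℝ) (n : ℕ) : ℝ :=
  ⨅ p : (Fin n → ℝ) × (Fin n → ℝ), wce1 α ℓ fun f => ∑ i, p.2 i * f (p.1 i)

/-- The multivariate Gaussian integral functional. -/
def IgaussD {d : ℕ} (α : Fin d → ℝ) (f : (Fin d → ℝ) → ℝ) : ℝ :=
  ∫ x : Fin d → ℝ,
    f x * ∏ i, (Real.sqrt (2 * Real.pi) * α i)⁻¹ * Real.exp (-(x i) ^ 2 / (2 * α i ^ 2))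

/-- Membership in the unit ball of the tensor-product Gaussian RKHS H(K_ℓ), ℓ ∈ ℝ^d. -/
def InBallD {d : ℕ} (ℓ : Fin d → ℝ) (f : (Fin d → ℝ) → ℝ) : Prop :=
  ∃ c : (Fin d → ℕ) → ℝ,
    (∀ x, HasSum (fun m => c m * ∏ i, phi (ℓ i) (m i) (x i)) (f x)) ∧
    Summable (fun m => c m ^ 2) ∧ (∑' m, c m ^ 2) ≤ 1

/-- Worst-case error of a multivariate quadrature functional. -/
def wceD {d : ℕ} (α ℓ : Fin d → ℝ) (Q : ((Fin d → ℝ) → ℝ) → ℝ) : ℝ :=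
  sSup {e : ℝ | ∃ f, InBallD ℓ f ∧ e = |IgaussD α f - Q f|}

/-- The N-th minimal worst-case error in dimension d. -/
def minErrD {d : ℕ} (α ℓ : Fin d → ℝ) (N : ℕ) : ℝ :=
  ⨅ p : (Fin N → (Fin d → ℝ)) × (Fin N → ℝ), wceD α ℓ fun f => ∑ i, p.2 i * f (p.1 i)

/-- The tensor-product scaled Gauss–Hermite rule. -/
def QGHD {d : ℕ} (α ℓ : Fin d → ℝ) (n : Fin d → ℕ)
    (x w : ∀ j, Fin (n j) → ℝ) (f : (Fin d → ℝ) → ℝ) : ℝ :=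
  ∑ i : ∀ j, Fin (n j),
    (∏ j, betaP (α j) (ℓ j) / α j * w j (i j) *
        Real.exp (betaP (α j) (ℓ j) ^ 2 * x j (i j) ^ 2 / (2 * ℓ j ^ 2))) *
      f fun j => betaP (α j) (ℓ j) * x j (i j)

/-- The power function of a finite point set (univariate). -/
def power1 (ℓ : ℝ) (X : Finset ℝ) (x : ℝ) : ℝ :=
  sSup {v : ℝ | ∃ f, InBall ℓ f ∧ (∀ y ∈ X, f y = 0) ∧ v = f x}

/-- Fill distance of X on Ω (univariate). -/
def fillDist1 (X : Finset ℝ) (Ω : Set ℝ) : ℝ :=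
  sSup {h : ℝ | ∃ x ∈ Ω, h = sInf {r : ℝ | ∃ y ∈ X, y ∈ Ω ∧ r = |x - y|}}

/-- Euclidean distance on ℝ^d. -/
def eucDist {d : ℕ} (x y : Fin d → ℝ) : ℝ := Real.sqrt (∑ i, (x i - y i) ^ 2)

/-- The power function of a finite point set in ℝ^d for the isotropic Gaussian kernel. -/
def powerD {d : ℕ} (ℓ : ℝ) (X : Finset (Fin d → ℝ)) (x : Fin d → ℝ) : ℝ :=
  sSup {v : ℝ | ∃ f, InBallD (fun _ => ℓ) f ∧ (∀ y ∈ X, f y = 0) ∧ v = f x}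

/-- Fill distance of X on Ω ⊂ ℝ^d (Euclidean). -/
def fillDistD {d : ℕ} (X : Finset (Fin d → ℝ)) (Ω : Set (Fin d → ℝ)) : ℝ :=
  sSup {h : ℝ | ∃ x ∈ Ω, h = sInf {r : ℝ | ∃ y ∈ X, y ∈ Ω ∧ r = eucDist x y}}

/-- Worst-case error of the optimal-weight (kernel quadrature) rule with nodes X (univariate). -/
def eopt1 (α ℓ : ℝ) (X : Finset ℝ) : ℝ :=
  ⨅ w : ℝ → ℝ, wce1 α ℓ fun f => ∑ y ∈ X, w y * f y

/-- Worst-case error of the optimal-weight rule with nodes X ⊂ ℝ^d. -/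
def eoptD {d : ℕ} (α ℓ : Fin d → ℝ) (X : Finset (Fin d → ℝ)) : ℝ :=
  ⨅ w : (Fin d → ℝ) → ℝ, wceD α ℓ fun f => ∑ y ∈ X, w y * f y

/-- The point sets X_k = ∪_{m=1}^k (Y_{k−m+1}^{m,+} ∪ Y_{k−m+1}^{m,−}). -/
def Xk (Y : ℕ → Finset ℝ) (k : ℕ) : Finset ℝ :=
  (Finset.Icc 1 k).biUnion fun m =>
    ((Y (k - m + 1)).image fun x => x + (m : ℝ) - 1) ∪
      ((Y (k - m + 1)).image fun x => x - (m : ℝ))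


lemma hasSum_phi_mul_phi {ℓ : ℝ} (hℓ : 0 < ℓ) (x y : ℝ) :
    HasSum (fun m => phi ℓ m x * phi ℓ m y) (Real.exp (-(x - y) ^ 2 / (2 * ℓ ^ 2))) := by
  have h := (NormedSpace.expSeries_div_hasSum_exp (x * y / ℓ ^ 2)).mul_right
    (Real.exp (-x ^ 2 / (2 * ℓ ^ 2)) * Real.exp (-y ^ 2 / (2 * ℓ ^ 2)))
  rw [← Real.exp_eq_exp_ℝ, ← Real.exp_add, ← Real.exp_add] at h
  have e1 : (fun m => phi ℓ m x * phi ℓ m y) = fun m : ℕ => (x * y / ℓ ^ 2) ^ m / m.factorial *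
      Real.exp (-x ^ 2 / (2 * ℓ ^ 2) + -y ^ 2 / (2 * ℓ ^ 2)) := by
    ext m
    have h1 : Real.sqrt (m.factorial : ℝ) ^ 2 = m.factorial := Real.sq_sqrt (Nat.cast_nonneg _)
    have h2 : Real.sqrt (m.factorial : ℝ) ≠ 0 := by positivity
    unfold phi
    rw [Real.exp_add, div_pow, mul_pow]
    field_simp
    rw [h1]
    ring
  have e2 : -(x - y) ^ 2 / (2 * ℓ ^ 2)
      = x * y / ℓ ^ 2 + (-x ^ 2 / (2 * ℓ ^ 2) + -y ^ 2 / (2 * ℓ ^ 2)) := by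
    field_simp
    ring
  rw [e1, e2]
  exact h

lemma hasSum_phi_sq {ℓ : ℝ} (hℓ : 0 < ℓ) (x : ℝ) : HasSum (fun m => phi ℓ m x ^ 2) 1 := by
  simpa [sq] using hasSum_phi_mul_phi hℓ x x

lemma continuous_phi (ℓ : ℝ) (m : ℕ) : Continuous (phi ℓ m) := by
  unfold phi
  fun_prop

lemma memℓp_two_of_summable_sq {c : ℕ → ℝ} (hc : Summable fun m => c m ^ 2) :
    Memℓp (E := fun _ : ℕ => ℝ) c 2 :=
  memℓp_gen (by simpa using hc)

/-- The feature map of the Gaussian kernel, with values in the space of square-summable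
sequences. -/
def gaussFeature {ℓ : ℝ} (hℓ : 0 < ℓ) (x : ℝ) : lp (fun _ : ℕ => ℝ) 2 :=
  ⟨fun m => phi ℓ m x, memℓp_two_of_summable_sq (hasSum_phi_sq hℓ x).summable⟩

lemma hasSum_lp_mul (c a : lp (fun _ : ℕ => ℝ) 2) :
    HasSum (fun m => c m * a m) (inner ℝ c a) := by
  simpa [mul_comm] using lp.hasSum_inner (𝕜 := ℝ) c a

lemma hasSum_lp_sq (c : lp (fun _ : ℕ => ℝ) 2) : HasSum (fun m => c m ^ 2) (‖c‖ ^ 2) := by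
  simpa [sq] using hasSum_lp_mul c c

lemma inner_gaussFeature {ℓ : ℝ} (hℓ : 0 < ℓ) (x y : ℝ) :
    inner ℝ (gaussFeature hℓ x) (gaussFeature hℓ y)
      = Real.exp (-(x - y) ^ 2 / (2 * ℓ ^ 2)) :=
  (hasSum_lp_mul _ _).unique (hasSum_phi_mul_phi hℓ x y)

lemma norm_gaussFeature {ℓ : ℝ} (hℓ : 0 < ℓ) (x : ℝ) : ‖gaussFeature hℓ x‖ = 1 := by
  have h := inner_gaussFeature hℓ x x
  rw [real_inner_self_eq_norm_sq] at h
  exact (sq_eq_sq₀ (norm_nonneg _) zero_le_one).1 (by rw [h]; simp)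

lemma continuous_gaussFeature {ℓ : ℝ} (hℓ : 0 < ℓ) : Continuous (gaussFeature hℓ) := by
  refine continuous_iff_continuousAt.2 fun x => ?_
  rw [ContinuousAt, tendsto_iff_norm_sub_tendsto_zero]
  have h : ∀ y, ‖gaussFeature hℓ y - gaussFeature hℓ x‖
      = Real.sqrt (2 - 2 * Real.exp (-(y - x) ^ 2 / (2 * ℓ ^ 2))) := fun y => by
    rw [← Real.sqrt_sq (norm_nonneg _), norm_sub_sq_real, inner_gaussFeature, norm_gaussFeature,
      norm_gaussFeature]
    ring_nf
  simp_rw [h]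
  have hc : Continuous fun y : ℝ =>
      Real.sqrt (2 - 2 * Real.exp (-(y - x) ^ 2 / (2 * ℓ ^ 2))) := by fun_prop
  simpa using hc.tendsto x

lemma inBall_inner {ℓ : ℝ} (hℓ : 0 < ℓ) {c : lp (fun _ : ℕ => ℝ) 2} (hc : ‖c‖ ≤ 1) :
    InBall ℓ fun x => inner ℝ c (gaussFeature hℓ x) :=
  ⟨c, fun x => hasSum_lp_mul c (gaussFeature hℓ x), (hasSum_lp_sq c).summable, by
    rw [(hasSum_lp_sq c).tsum_eq]
    exact pow_le_one₀ (norm_nonneg _) hc⟩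

lemma InBall.exists_inner {ℓ : ℝ} (hℓ : 0 < ℓ) {f : ℝ → ℝ} (hf : InBall ℓ f) :
    ∃ c : lp (fun _ : ℕ => ℝ) 2, ‖c‖ ≤ 1 ∧ ∀ x, f x = inner ℝ c (gaussFeature hℓ x) := by
  obtain ⟨c, hcf, hc, hc1⟩ := hf
  refine ⟨⟨c, memℓp_two_of_summable_sq hc⟩, ?_, fun x => (hcf x).unique (hasSum_lp_mul _ _)⟩
  rw [← sq_le_one_iff₀ (norm_nonneg _), ← (hasSum_lp_sq _).tsum_eq]
  exact hc1

lemma InBall.abs_sub_le {ℓ : ℝ} (hℓ : 0 < ℓ) {f : ℝ → ℝ} (hf : InBall ℓ f) (x y : ℝ) :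
    |f x - f y| ≤ ‖gaussFeature hℓ x - gaussFeature hℓ y‖ := by
  obtain ⟨c, hc, hcf⟩ := hf.exists_inner hℓ
  rw [hcf, hcf, ← inner_sub_right]
  exact (abs_real_inner_le_norm _ _).trans (mul_le_of_le_one_left (norm_nonneg _) hc)

lemma InBall.abs_le_one {ℓ : ℝ} (hℓ : 0 < ℓ) {f : ℝ → ℝ} (hf : InBall ℓ f) (x : ℝ) :
    |f x| ≤ 1 := by
  obtain ⟨c, hc, hcf⟩ := hf.exists_inner hℓ
  rw [hcf]
  refine (abs_real_inner_le_norm _ _).trans ?_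
  rwa [norm_gaussFeature, mul_one]

lemma InBall.le_power1 {ℓ : ℝ} (hℓ : 0 < ℓ) {f : ℝ → ℝ} (hf : InBall ℓ f) {X : Finset ℝ}
    (hX : ∀ y ∈ X, f y = 0) (x : ℝ) : f x ≤ power1 ℓ X x :=
  le_csSup ⟨1, by rintro _ ⟨g, hg, -, rfl⟩; exact (abs_le.1 (hg.abs_le_one hℓ x)).2⟩
    ⟨f, hf, hX, rfl⟩

lemma inBall_zero (ℓ : ℝ) : InBall ℓ 0 :=
  ⟨0, fun x => by simp, by simp, by simp⟩

lemma power1_nonneg {ℓ : ℝ} (hℓ : 0 < ℓ) (X : Finset ℝ) (x : ℝ) : 0 ≤ power1 ℓ X x :=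
  (inBall_zero ℓ).le_power1 hℓ (fun _ _ => rfl) x

lemma power1_le_one {ℓ : ℝ} (hℓ : 0 < ℓ) (X : Finset ℝ) (x : ℝ) : power1 ℓ X x ≤ 1 :=
  Real.sSup_le (by rintro _ ⟨g, hg, -, rfl⟩; exact (abs_le.1 (hg.abs_le_one hℓ x)).2) zero_le_one

lemma power1_sub_le {ℓ : ℝ} (hℓ : 0 < ℓ) (X : Finset ℝ) (x y : ℝ) :
    power1 ℓ X x - power1 ℓ X y ≤ ‖gaussFeature hℓ x - gaussFeature hℓ y‖ := by
  rw [sub_le_iff_le_add]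
  refine Real.sSup_le ?_ (add_nonneg (norm_nonneg _) (power1_nonneg hℓ X y))
  rintro _ ⟨g, hg, hX, rfl⟩
  have h1 := (abs_le.1 (hg.abs_sub_le hℓ x y)).2
  have h2 := hg.le_power1 hℓ hX y
  linarith

lemma continuous_power1 {ℓ : ℝ} (hℓ : 0 < ℓ) (X : Finset ℝ) : Continuous (power1 ℓ X) := by
  refine continuous_iff_continuousAt.2 fun x => ?_
  have h0 : Tendsto (fun y => ‖gaussFeature hℓ y - gaussFeature hℓ x‖) (nhds x) (nhds 0) :=
    tendsto_iff_norm_sub_tendsto_zero.1 ((continuous_gaussFeature hℓ).tendsto x)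
  rw [ContinuousAt, tendsto_iff_norm_sub_tendsto_zero]
  refine squeeze_zero (fun _ => norm_nonneg _) (fun y => ?_) h0
  rw [Real.norm_eq_abs, abs_sub_le_iff]
  refine ⟨power1_sub_le hℓ X y x, ?_⟩
  rw [norm_sub_rev]
  exact power1_sub_le hℓ X x y

/-- Term-by-term integration of an expansion with square-summable coefficients in features that
are pointwise of unit square sum. -/
lemma hasSum_integral_features {ι β : Type*} [Countable ι] [MeasurableSpace β] {μ : Measure β}
    {F : ι → β → ℝ} (hF : ∀ i, Measurable (F i)) (hF1 : ∀ x, HasSum (fun i => F i x ^ 2) 1)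
    {g : β → ℝ} (hg0 : ∀ x, 0 ≤ g x) (hg : Integrable g μ) {c : ι → ℝ}
    (hc : Summable fun i => c i ^ 2) {f : β → ℝ} (hf : ∀ x, HasSum (fun i => c i * F i x) (f x)) :
    HasSum (fun i => c i * ∫ x, F i x * g x ∂μ) (∫ x, f x * g x ∂μ) := by
  have hb : ∀ x, HasSum (fun i => (c i ^ 2 + F i x ^ 2) / 2 * g x)
      (((∑' i, c i ^ 2) + 1) / 2 * g x) := fun x =>
    ((hc.hasSum.add (hF1 x)).div_const 2).mul_right _
  have h := hasSum_integral_of_dominated_convergence (μ := μ)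
    (F := fun i x => c i * F i x * g x) (f := fun x => f x * g x)
    (fun i x => (c i ^ 2 + F i x ^ 2) / 2 * g x)
    (fun i => ((hF i).const_mul (c i)).aestronglyMeasurable.mul hg.aestronglyMeasurable)
    (fun i => Eventually.of_forall fun x => by
      rw [norm_mul, Real.norm_eq_abs, Real.norm_of_nonneg (hg0 x)]
      refine mul_le_mul_of_nonneg_right (abs_le.2 ⟨?_, ?_⟩) (hg0 x)
      · nlinarith [sq_nonneg (c i + F i x)]
      · nlinarith [sq_nonneg (c i - F i x)])
    (Eventually.of_forall fun x => (hb x).summable)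
    (by simpa only [(hb _).tsum_eq] using hg.const_mul _)
    (Eventually.of_forall fun x => (hf x).mul_right _)
  simpa only [mul_assoc, integral_const_mul] using h

/-- The integrals of features of unit square sum against a probability density are
square-summable with sum at most one. -/
lemma sum_integral_features_sq_le {β : Type*} [MeasurableSpace β] {μ : Measure β}
    {F : ℕ → β → ℝ} (hF : ∀ i, Measurable (F i)) (hF1 : ∀ x, HasSum (fun i => F i x ^ 2) 1)
    {g : β → ℝ} (hg0 : ∀ x, 0 ≤ g x) (hg : Integrable g μ) (hg1 : ∫ x, g x ∂μ = 1)
    (s : Finset ℕ) : ∑ i ∈ s, (∫ x, F i x * g x ∂μ) ^ 2 ≤ 1 := by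
  set v : ℕ → ℝ := fun i => ∫ x, F i x * g x ∂μ with hv
  have hint : ∀ i, Integrable (fun x => v i * (F i x * g x)) μ := fun i => by
    refine (hg.bdd_mul (c := 1) (hF i).aestronglyMeasurable
      (Eventually.of_forall fun x => ?_)).const_mul _
    rw [Real.norm_eq_abs, ← sq_le_one_iff_abs_le_one]
    exact le_hasSum (hF1 x) i fun j _ => sq_nonneg _
  have h1 : ∑ i ∈ s, v i ^ 2 = ∫ x, ∑ i ∈ s, v i * (F i x * g x) ∂μ := by
    rw [integral_finsetSum _ fun i _ => hint i]
    exact Finset.sum_congr rfl fun i _ => by rw [integral_const_mul, sq]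
  have h2 : ∫ x, ∑ i ∈ s, v i * (F i x * g x) ∂μ
      ≤ ∫ x, ((∑ i ∈ s, v i ^ 2) + 1) / 2 * g x ∂μ := by
    refine integral_mono (integrable_finsetSum _ fun i _ => hint i) (hg.const_mul _) fun x => ?_
    have h3 : ∑ i ∈ s, F i x ^ 2 ≤ 1 := sum_le_hasSum s (fun _ _ => sq_nonneg _) (hF1 x)
    have h4 : ∑ i ∈ s, v i * F i x ≤ ∑ i ∈ s, (v i ^ 2 + F i x ^ 2) / 2 :=
      Finset.sum_le_sum fun i _ => by nlinarith [sq_nonneg (v i - F i x)]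
    rw [← Finset.sum_div, Finset.sum_add_distrib] at h4
    simp only [← mul_assoc, ← Finset.sum_mul]
    exact mul_le_mul_of_nonneg_right (by linarith) (hg0 x)
  rw [integral_const_mul, hg1, ← h1] at h2
  change ∑ i ∈ s, v i ^ 2 ≤ 1
  linarith

lemma HasSum.pi_prod {d : ℕ} {g : Fin d → ℕ → ℝ} {s : Fin d → ℝ} (h : ∀ i, HasSum (g i) (s i)) :
    HasSum (fun m : Fin d → ℕ => ∏ i, g i (m i)) (∏ i, s i) := by
  induction d with
  | zero => simp
  | succ d ih =>
    have h1 := ih (g := fun i => g i.succ) (s := fun i => s i.succ) fun i => h i.succ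
    have hs := summable_mul_of_summable_norm (h 0).summable.norm h1.summable.norm
    have h2 := (h 0).mul h1 hs
    let e : ℕ × (Fin d → ℕ) ≃ (Fin (d + 1) → ℕ) := Fin.consEquiv fun _ => ℕ
    rw [Fin.prod_univ_succ]
    refine e.hasSum_iff.1 ?_
    have h3 : (fun m : Fin (d + 1) → ℕ => ∏ i, g i (m i)) ∘ e
        = fun p => g 0 p.1 * ∏ i, g (Fin.succ i) (p.2 i) := by
      ext p
      simp [e, Fin.consEquiv, Fin.prod_univ_succ]
    rw [h3]
    exact h2

lemma pow_sub_pow_le_mul_sub {a b : ℝ} (hb : 0 ≤ b) (hba : b ≤ a) (ha : a ≤ 1) (d : ℕ) :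
    a ^ d - b ^ d ≤ d * (a - b) := by
  induction d with
  | zero => simp
  | succ d ih =>
    have h1 : b ^ d ≤ 1 := pow_le_one₀ hb (hba.trans ha)
    have h2 : b ^ d ≤ a ^ d := pow_le_pow_left₀ hb hba d
    rw [pow_succ, pow_succ]
    push_cast
    nlinarith [mul_nonneg (sub_nonneg.2 h2) (sub_nonneg.2 ha),
      mul_nonneg (sub_nonneg.2 hba) (sub_nonneg.2 h1)]

/-- The density of the centred normal distribution with standard deviation `α`. -/
def gaussDensity (α x : ℝ) : ℝ := (Real.sqrt (2 * Real.pi) * α)⁻¹ * Real.exp (-x ^ 2 / (2 * α ^ 2))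

lemma gaussDensity_nonneg {α : ℝ} (hα : 0 < α) (x : ℝ) : 0 ≤ gaussDensity α x := by
  unfold gaussDensity
  positivity

lemma neg_sq_div_eq (b x : ℝ) : -x ^ 2 / b = -b⁻¹ * x ^ 2 := by
  rw [div_eq_mul_inv]
  ring

lemma integrable_gaussDensity {α : ℝ} (hα : 0 < α) : Integrable (gaussDensity α) := by
  have h := (integrable_exp_neg_mul_sq (b := (2 * α ^ 2)⁻¹) (by positivity)).const_mul
    (Real.sqrt (2 * Real.pi) * α)⁻¹
  simp only [← neg_sq_div_eq] at h
  exact h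

lemma integral_gaussDensity {α : ℝ} (hα : 0 < α) : ∫ x, gaussDensity α x = 1 := by
  unfold gaussDensity
  rw [integral_const_mul]
  simp only [neg_sq_div_eq]
  rw [integral_gaussian, div_inv_eq_mul, show Real.pi * (2 * α ^ 2) = 2 * Real.pi * α ^ 2 by ring,
    Real.sqrt_mul (x := 2 * Real.pi) (by positivity), Real.sqrt_sq hα.le]
  exact inv_mul_cancel₀ (by positivity)

/-- The coefficients of the Gaussian integral functional in the basis `phi`. -/
def gaussMoment (α ℓ : ℝ) (m : ℕ) : ℝ := ∫ x, phi ℓ m x * gaussDensity α x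

lemma exists_weights {α ℓ E : ℝ} (hα : 0 < α) (hℓ : 0 < ℓ) (X : Finset ℝ)
    (hE : ∫ x, power1 ℓ X x * gaussDensity α x ≤ E) :
    ∃ w : ℝ → ℝ, ∃ a b : ℝ, HasSum (fun m => gaussMoment α ℓ m ^ 2) a ∧
      HasSum (fun m => (∑ y ∈ X, w y * phi ℓ m y) ^ 2) b ∧
      HasSum (fun m => gaussMoment α ℓ m * ∑ y ∈ X, w y * phi ℓ m y) b ∧
      a ≤ 1 ∧ b ≤ a ∧ a - b ≤ E ^ 2 := by
  have hg := integrable_gaussDensity hα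
  have hg0 := gaussDensity_nonneg hα
  have hFm : ∀ m, Measurable (phi ℓ m) := fun m => (continuous_phi ℓ m).measurable
  have hsum := sum_integral_features_sq_le (μ := volume) hFm (hasSum_phi_sq hℓ) hg0 hg
    (integral_gaussDensity hα)
  have hvs : Summable fun m => gaussMoment α ℓ m ^ 2 :=
    summable_of_sum_le (fun _ => sq_nonneg _) hsum
  let v : lp (fun _ : ℕ => ℝ) 2 := ⟨gaussMoment α ℓ, memℓp_two_of_summable_sq hvs⟩
  have hva : HasSum (fun m => gaussMoment α ℓ m ^ 2) (‖v‖ ^ 2) := hasSum_lp_sq v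
  have hinner : ∀ c : lp (fun _ : ℕ => ℝ) 2,
      inner ℝ c v = ∫ x, inner ℝ c (gaussFeature hℓ x) * gaussDensity α x := fun c =>
    (hasSum_lp_mul c v).unique (hasSum_integral_features hFm (hasSum_phi_sq hℓ) hg0 hg
      (hasSum_lp_sq c).summable fun x => hasSum_lp_mul c (gaussFeature hℓ x))
  classical
  let S : Submodule ℝ (lp (fun _ : ℕ => ℝ) 2) :=
    Submodule.span ℝ (X.image (gaussFeature hℓ) : Finset _)
  have : FiniteDimensional ℝ S := FiniteDimensional.span_finset ℝ _
  set u := S.starProjection v with hu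
  have huS : u ∈ S := S.starProjection_apply_mem v
  have horth : ∀ z ∈ S, inner ℝ (v - u) z = 0 := fun z hz => S.starProjection_inner_eq_zero v z hz
  obtain ⟨w, hw⟩ : ∃ w : ℝ → ℝ, ∑ y ∈ X, w y • gaussFeature hℓ y = u := by
    have h1 := huS
    simp only [S, Finset.coe_image] at h1
    rwa [Submodule.mem_span_image_finset_iff_exists_fun'] at h1
  have huw : ∀ m, u m = ∑ y ∈ X, w y * phi ℓ m y := fun m => by
    rw [← hw, lp.coeFn_sum, Finset.sum_apply]
    rfl
  have hvu : inner ℝ v u = ‖u‖ ^ 2 := by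
    have h1 := horth u huS
    rw [inner_sub_left, real_inner_self_eq_norm_sq] at h1
    linarith
  have hsq : ‖v - u‖ ^ 2 = ‖v‖ ^ 2 - ‖u‖ ^ 2 := by
    rw [norm_sub_sq_real, hvu]
    ring
  have hP0 : 0 ≤ ∫ x, power1 ℓ X x * gaussDensity α x :=
    integral_nonneg fun x => mul_nonneg (power1_nonneg hℓ X x) (hg0 x)
  have hnorm : ‖v - u‖ ≤ E := by
    rcases eq_or_ne (v - u) 0 with h0 | h0
    · rw [h0, norm_zero]
      exact hP0.trans hE
    have hpos : 0 < ‖v - u‖ := norm_pos_iff.2 h0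
    have hself : inner ℝ (v - u) v = ‖v - u‖ ^ 2 := by
      have h1 := horth u huS
      have h2 : inner ℝ (v - u) (v - u) = ‖v - u‖ ^ 2 := real_inner_self_eq_norm_sq _
      rw [inner_sub_right, h1, sub_zero] at h2
      exact h2
    set c := ‖v - u‖⁻¹ • (v - u) with hc
    have hc1 : ‖c‖ ≤ 1 := by
      rw [hc, norm_smul, norm_inv, norm_norm, inv_mul_cancel₀ hpos.ne']
    have hcv : inner ℝ c v = ‖v - u‖ := by
      rw [hc, real_inner_smul_left, hself]
      field_simp
    have hball := inBall_inner hℓ hc1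
    have hzero : ∀ y ∈ X, inner ℝ c (gaussFeature hℓ y) = 0 := fun y hy => by
      rw [hc, real_inner_smul_left, horth, mul_zero]
      exact Submodule.subset_span (Finset.mem_coe.2 (Finset.mem_image_of_mem _ hy))
    rw [← hcv, hinner]
    refine le_trans (integral_mono ?_ ?_ fun x =>
      mul_le_mul_of_nonneg_right (hball.le_power1 hℓ hzero x) (hg0 x)) hE
    · refine hg.bdd_mul (c := 1) ?_ (Eventually.of_forall fun x => hball.abs_le_one hℓ x)
      exact (continuous_const.inner (continuous_gaussFeature hℓ)).aestronglyMeasurable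
    · refine hg.bdd_mul (c := 1) (continuous_power1 hℓ X).aestronglyMeasurable
        (Eventually.of_forall fun x => ?_)
      rw [Real.norm_of_nonneg (power1_nonneg hℓ X x)]
      exact power1_le_one hℓ X x
  refine ⟨w, ‖v‖ ^ 2, ‖u‖ ^ 2, hva, ?_, ?_, hasSum_le_of_sum_le hva hsum, ?_, ?_⟩
  · simpa only [huw] using hasSum_lp_sq u
  · have h1 := hasSum_lp_mul v u
    rw [hvu] at h1
    simpa only [huw] using h1
  · nlinarith [sq_nonneg ‖v - u‖]
  · rw [← hsq]
    exact pow_le_pow_left₀ (norm_nonneg _) hnorm 2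

lemma hasSum_mul_le {ι : Type*} {c a : ι → ℝ} {s A D : ℝ} (hD : 0 < D)
    (hc : Summable fun i => c i ^ 2) (hc1 : ∑' i, c i ^ 2 ≤ 1) (ha : HasSum (fun i => a i ^ 2) A)
    (hAD : A ≤ D ^ 2) (hs : HasSum (fun i => c i * a i) s) : |s| ≤ D := by
  have h1 : HasSum (fun i => (c i ^ 2 * D + a i ^ 2 / D) / 2) (((∑' i, c i ^ 2) * D + A / D) / 2) :=
    ((hc.hasSum.mul_right D).add (ha.div_const D)).div_const 2
  have h2 : ((∑' i, c i ^ 2) * D + A / D) / 2 ≤ D := by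
    have h3 : A / D ≤ D := (div_le_iff₀ hD).2 (by nlinarith)
    nlinarith
  have h4 : ∀ t r : ℝ, t * r ≤ (t ^ 2 * D + r ^ 2 / D) / 2 := fun t r => by
    have h5 : (t ^ 2 * D + r ^ 2 / D) / 2 - t * r = (t * D - r) ^ 2 / (2 * D) := by
      field_simp
      ring
    have h6 : 0 ≤ (t * D - r) ^ 2 / (2 * D) := by positivity
    linarith
  refine abs_le'.2 ⟨(hasSum_le (fun i => h4 _ _) hs h1).trans h2,
    (hasSum_le (fun i => ?_) hs.neg h1).trans h2⟩
  simpa using h4 (-c i) (a i)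

lemma eoptD_le_of_integral_power1_le {d : ℕ} (hd : 0 < d) {α ℓ E : ℝ} (hα : 0 < α) (hℓ : 0 < ℓ)
    (hE0 : 0 < E) (X : Finset ℝ) (hE : ∫ x, power1 ℓ X x * gaussDensity α x ≤ E) :
    eoptD (fun _ : Fin d => α) (fun _ => ℓ) (Fintype.piFinset fun _ : Fin d => X)
      ≤ Real.sqrt d * E := by
  obtain ⟨w, a, b, ha, hb, hab, ha1, hba, hE2⟩ := exists_weights hα hℓ X hE
  have hb0 : 0 ≤ b := hb.nonneg fun _ => sq_nonneg _
  have hd' : (0 : ℝ) < d := by exact_mod_cast hd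
  refine (ciInf_le ?_ fun y => ∏ i, w (y i)).trans ?_
  · refine ⟨0, ?_⟩
    rintro _ ⟨w, rfl⟩
    refine Real.sSup_nonneg ?_
    rintro _ ⟨f, -, rfl⟩
    exact abs_nonneg _
  refine Real.sSup_le ?_ (by positivity)
  rintro _ ⟨f, ⟨c, hcf, hc, hc1⟩, rfl⟩
  have hI : HasSum (fun m : Fin d → ℕ => c m * ∏ i, gaussMoment α ℓ (m i))
      (IgaussD (fun _ => α) f) := by
    have h1 := hasSum_integral_features (μ := (volume : Measure (Fin d → ℝ)))
      (F := fun (m : Fin d → ℕ) x => ∏ i, phi ℓ (m i) (x i))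
      (g := fun x => ∏ i, gaussDensity α (x i))
      (fun m => Finset.measurable_prod _ fun i _ =>
        (continuous_phi ℓ (m i)).measurable.comp (measurable_pi_apply i))
      (fun x => by
        have h2 := HasSum.pi_prod fun i => hasSum_phi_sq hℓ (x i)
        simpa only [Finset.prod_pow, Finset.prod_const_one] using h2)
      (fun x => Finset.prod_nonneg fun i _ => gaussDensity_nonneg hα _)
      (Integrable.fintype_prod fun _ => integrable_gaussDensity hα) hc hcf
    simp only [← Finset.prod_mul_distrib] at h1
    have h2 : ∀ m : Fin d → ℕ, ∫ x : Fin d → ℝ, ∏ i, phi ℓ (m i) (x i) * gaussDensity α (x i)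
        = ∏ i, gaussMoment α ℓ (m i) := fun m =>
      integral_fintype_prod_volume_eq_prod fun i t => phi ℓ (m i) t * gaussDensity α t
    simp only [h2] at h1
    exact h1
  have hQ : HasSum (fun m : Fin d → ℕ => c m * ∏ i, ∑ y ∈ X, w y * phi ℓ (m i) y)
      (∑ y ∈ Fintype.piFinset fun _ : Fin d => X, (∏ i, w (y i)) * f y) := by
    have h1 := hasSum_sum (s := Fintype.piFinset fun _ : Fin d => X)
      fun y _ => (hcf y).mul_left (∏ i, w (y i))
    refine h1.congr_fun fun m => ?_
    rw [Finset.prod_univ_sum, Finset.mul_sum]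
    refine Finset.sum_congr rfl fun y _ => ?_
    rw [Finset.prod_mul_distrib]
    ring
  have hA : HasSum (fun m : Fin d → ℕ =>
      (∏ i, gaussMoment α ℓ (m i) - ∏ i, ∑ y ∈ X, w y * phi ℓ (m i) y) ^ 2) (a ^ d - b ^ d) := by
    have h1 := HasSum.pi_prod fun _ : Fin d => ha
    have h2 := HasSum.pi_prod fun _ : Fin d => hb
    have h3 := HasSum.pi_prod fun _ : Fin d => hab
    simp only [Finset.prod_const, Finset.card_univ, Fintype.card_fin, Finset.prod_pow,
      Finset.prod_mul_distrib] at h1 h2 h3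
    have h4 := (h1.sub (h3.mul_left 2)).add h2
    rw [show a ^ d - b ^ d = a ^ d - 2 * b ^ d + b ^ d by ring]
    refine h4.congr_fun fun m => ?_
    ring
  have hs := hI.sub hQ
  simp only [← mul_sub] at hs
  refine hasSum_mul_le (by positivity) hc hc1 hA ?_ hs
  rw [mul_pow, Real.sq_sqrt hd'.le]
  exact (pow_sub_pow_le_mul_sub hb0 hba ha1 d).trans (mul_le_mul_of_nonneg_left hE2 hd'.le)

lemma bddAbove_fillDist1_set {X : Finset ℝ} {a b : ℝ} {Ω : Set ℝ} (hΩ : Ω ⊆ Set.Icc a b)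
    (hX : ∃ y ∈ X, y ∈ Ω) :
    BddAbove {h : ℝ | ∃ x ∈ Ω, h = sInf {r : ℝ | ∃ y ∈ X, y ∈ Ω ∧ r = |x - y|}} := by
  obtain ⟨y, hy, hyΩ⟩ := hX
  refine ⟨b - a, ?_⟩
  rintro _ ⟨x, hx, rfl⟩
  have hmem : |x - y| ∈ {r : ℝ | ∃ y ∈ X, y ∈ Ω ∧ r = |x - y|} := ⟨y, hy, hyΩ, rfl⟩
  refine (csInf_le ⟨0, ?_⟩ hmem).trans (abs_le.2 ?_)
  · rintro _ ⟨z, -, -, rfl⟩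
    exact abs_nonneg _
  · have h1 := hΩ hx
    have h2 := hΩ hyΩ
    exact ⟨by linarith [h1.1, h2.2], by linarith [h1.2, h2.1]⟩

lemma fillDist1_pos {X : Finset ℝ} {a b : ℝ} (hab : a < b) (hX : ∃ y ∈ X, y ∈ Set.Icc a b) :
    0 < fillDist1 X (Set.Icc a b) := by
  obtain ⟨x, hx, hxX⟩ := ((Set.Icc_infinite hab).sdiff X.finite_toSet).nonempty
  have hne : {r : ℝ | ∃ y ∈ X, y ∈ Set.Icc a b ∧ r = |x - y|}.Nonempty := by
    obtain ⟨y, hy, hyI⟩ := hX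
    exact ⟨_, y, hy, hyI, rfl⟩
  have hfin : {r : ℝ | ∃ y ∈ X, y ∈ Set.Icc a b ∧ r = |x - y|}.Finite := by
    refine (X.finite_toSet.image fun y => |x - y|).subset ?_
    rintro _ ⟨y, hy, -, rfl⟩
    exact ⟨y, hy, rfl⟩
  obtain ⟨y, hy, -, hr⟩ := hne.csInf_mem hfin
  refine lt_of_lt_of_le ?_ (le_csSup (bddAbove_fillDist1_set subset_rfl hX) ⟨x, hx, rfl⟩)
  rw [hr, abs_pos, sub_ne_zero]
  rintro rfl
  exact hxX hy

lemma fillDist1_Icc_le_of_translate {X Y : Finset ℝ} {a δ : ℝ} (hδ : 0 ≤ δ) (hne : Y.Nonempty)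
    (hY : (Y : Set ℝ) ⊆ Set.Ioo 0 1) (hYX : ∀ y ∈ Y, y + a ∈ X)
    (hfill : fillDist1 Y (Set.Ioo 0 1) ≤ δ) : fillDist1 X (Set.Icc a (a + 1)) ≤ δ := by
  refine Real.sSup_le ?_ hδ
  rintro _ ⟨x, hx, rfl⟩
  refine le_of_forall_pos_le_add fun ε hε => ?_
  have hxcl : x - a ∈ closure (Set.Ioo (0 : ℝ) 1) := by
    rw [closure_Ioo zero_ne_one]
    exact ⟨by linarith [hx.1], by linarith [hx.2]⟩
  obtain ⟨z, hz, hzx⟩ := Metric.mem_closure_iff.1 hxcl (ε / 2) (half_pos hε)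
  obtain ⟨y₀, hy₀⟩ := hne
  have h1 : sInf {r : ℝ | ∃ y ∈ Y, y ∈ Set.Ioo (0 : ℝ) 1 ∧ r = |z - y|} ≤ δ :=
    (le_csSup (bddAbove_fillDist1_set Set.Ioo_subset_Icc_self ⟨y₀, hy₀, hY hy₀⟩)
      ⟨z, hz, rfl⟩).trans hfill
  have hne : {r : ℝ | ∃ y ∈ Y, y ∈ Set.Ioo (0 : ℝ) 1 ∧ r = |z - y|}.Nonempty :=
    ⟨_, y₀, hy₀, hY hy₀, rfl⟩
  obtain ⟨_, ⟨y, hy, hyI, rfl⟩, hr⟩ :=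
    exists_lt_of_csInf_lt hne (h1.trans_lt (lt_add_of_pos_right δ (half_pos hε)))
  have hmem : |x - (y + a)| ∈ {r : ℝ | ∃ y ∈ X, y ∈ Set.Icc a (a + 1) ∧ r = |x - y|} :=
    ⟨y + a, hYX y hy, ⟨by linarith [hyI.1], by linarith [hyI.2]⟩, rfl⟩
  refine (csInf_le ⟨0, ?_⟩ hmem).trans ?_
  · rintro _ ⟨w, -, -, rfl⟩
    exact abs_nonneg _
  · rw [Real.dist_eq] at hzx
    have h2 := abs_add_le (x - a - z) (z - y)
    rw [show x - a - z + (z - y) = x - (y + a) by ring] at h2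
    linarith

lemma exists_translate_subset_Xk (Y : ℕ → Finset ℝ) {k n : ℕ} (hn : n < 2 * (k / 2)) :
    ∃ p : ℕ, 1 ≤ p ∧ k ≤ 2 * p ∧ ∀ y ∈ Y p, y + (-((k / 2 : ℕ) : ℝ) + n) ∈ Xk Y k := by
  set J := k / 2 with hJ
  rcases lt_or_ge n J with h | h
  · refine ⟨k - (J - n) + 1, by omega, by omega, fun y hy => ?_⟩
    refine Finset.mem_biUnion.2 ⟨J - n, Finset.mem_Icc.2 ⟨by omega, by omega⟩,
      Finset.mem_union_right _ (Finset.mem_image.2 ⟨y, hy, ?_⟩)⟩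
    rw [Nat.cast_sub h.le]
    ring
  · refine ⟨k - (n - J + 1) + 1, by omega, by omega, fun y hy => ?_⟩
    refine Finset.mem_biUnion.2 ⟨n - J + 1, Finset.mem_Icc.2 ⟨by omega, by omega⟩,
      Finset.mem_union_left _ (Finset.mem_image.2 ⟨y, hy, ?_⟩)⟩
    push_cast [Nat.cast_sub h]
    ring

/-- Exponential decay of `exp (C log h / h)` in `1 / h`, at any prescribed rate. -/
lemma exp_log_div_le {C R t h : ℝ} (hC : 0 < C) (hR : 0 ≤ R) (hh : 0 < h) (hht : h * t ≤ 1) :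
    Real.exp (C * Real.log h / h) ≤ Real.exp (C * Real.exp (R / C)) * Real.exp (-R * t) := by
  rw [← Real.exp_add, Real.exp_le_exp, div_le_iff₀ hh]
  have h1 : Real.log h + R / C ≤ h * Real.exp (R / C) - 1 := by
    have h2 := Real.log_le_sub_one_of_pos (mul_pos hh (Real.exp_pos (R / C)))
    rwa [Real.log_mul hh.ne' (Real.exp_pos _).ne', Real.log_exp] at h2
  have h3 : C * (Real.log h + R / C) ≤ C * (h * Real.exp (R / C) - 1) :=
    mul_le_mul_of_nonneg_left h1 hC.le
  rw [mul_add, mul_div_cancel₀ _ hC.ne'] at h3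
  nlinarith [mul_le_mul_of_nonneg_left hht hR]

lemma gaussDensity_le {α : ℝ} (hα : 0 < α) (x : ℝ) :
    gaussDensity α x ≤ (Real.sqrt (2 * Real.pi) * α)⁻¹ := by
  unfold gaussDensity
  refine mul_le_of_le_one_right (by positivity) (Real.exp_le_one_iff.2 ?_)
  exact div_nonpos_of_nonpos_of_nonneg (by nlinarith [sq_nonneg x]) (by positivity)

/-- Away from an interval around zero, the Gaussian density decays exponentially at any
prescribed rate, relative to a Gaussian function of larger variance. -/
lemma gaussDensity_le_of_le_abs {α r t x : ℝ} (hα : 0 < α) (hr : 0 ≤ r) (hx : t ≤ |x|) :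
    gaussDensity α x ≤ Real.exp (-r * t) *
      ((Real.sqrt (2 * Real.pi) * α)⁻¹ * Real.exp (r ^ 2 * α ^ 2) *
        Real.exp (-(4 * α ^ 2)⁻¹ * x ^ 2)) := by
  have h1 : -x ^ 2 / (2 * α ^ 2) ≤ -r * t + (r ^ 2 * α ^ 2 + -(4 * α ^ 2)⁻¹ * x ^ 2) := by
    have h2 : r * t ≤ r * |x| := mul_le_mul_of_nonneg_left hx hr
    have h3 : -r * |x| + (r ^ 2 * α ^ 2 + -(4 * α ^ 2)⁻¹ * |x| ^ 2) - -|x| ^ 2 / (2 * α ^ 2)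
        = (|x| / (2 * α) - r * α) ^ 2 := by
      field_simp
      ring
    rw [sq_abs] at h3
    nlinarith [sq_nonneg (|x| / (2 * α) - r * α)]
  unfold gaussDensity
  calc _ ≤ (Real.sqrt (2 * Real.pi) * α)⁻¹ *
        Real.exp (-r * t + (r ^ 2 * α ^ 2 + -(4 * α ^ 2)⁻¹ * x ^ 2)) :=
        mul_le_mul_of_nonneg_left (Real.exp_le_exp.2 h1) (by positivity)
    _ = _ := by
        rw [Real.exp_add, Real.exp_add]
        ring

lemma integral_power1_mul_gaussDensity_le {α ℓ r B : ℝ} (hα : 0 < α) (hℓ : 0 < ℓ) (hr : 0 ≤ r)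
    (X : Finset ℝ) (J : ℕ)
    (hB : ∀ n < 2 * J, ∫ x in Set.Icc (-(J : ℝ) + n) (-(J : ℝ) + n + 1), power1 ℓ X x ≤ B) :
    ∫ x, power1 ℓ X x * gaussDensity α x
      ≤ (Real.sqrt (2 * Real.pi) * α)⁻¹ * (2 * J * B) + Real.exp (-r * J) *
        ∫ x, (Real.sqrt (2 * Real.pi) * α)⁻¹ * Real.exp (r ^ 2 * α ^ 2) *
          Real.exp (-(4 * α ^ 2)⁻¹ * x ^ 2) := by
  set G := (Real.sqrt (2 * Real.pi) * α)⁻¹ with hG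
  have hG0 : 0 ≤ G := by positivity
  set T : ℝ → ℝ := fun x => G * Real.exp (r ^ 2 * α ^ 2) * Real.exp (-(4 * α ^ 2)⁻¹ * x ^ 2)
  have hT : Integrable T := (integrable_exp_neg_mul_sq (by positivity)).const_mul _
  have hT0 : ∀ x, 0 ≤ T x := fun x => by positivity
  have hP := continuous_power1 hℓ X
  have hii : ∀ a b, IntervalIntegrable (power1 ℓ X) volume a b := fun a b =>
    hP.intervalIntegrable a b
  set s := Set.Ioc (-(J : ℝ)) J with hs
  have hPs : IntegrableOn (fun x => G * power1 ℓ X x) s :=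
    ((hP.integrableOn_Icc (a := -(J : ℝ)) (b := J)).mono_set Set.Ioc_subset_Icc_self).const_mul G
  have hPg : Integrable fun x => power1 ℓ X x * gaussDensity α x := by
    refine (integrable_gaussDensity hα).bdd_mul (c := 1) hP.aestronglyMeasurable
      (Eventually.of_forall fun x => ?_)
    rw [Real.norm_of_nonneg (power1_nonneg hℓ X x)]
    exact power1_le_one hℓ X x
  have hle : ∀ x, power1 ℓ X x * gaussDensity α x
      ≤ s.indicator (fun x => G * power1 ℓ X x) x + Real.exp (-r * J) * T x := fun x => by
    by_cases hx : x ∈ s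
    · rw [Set.indicator_of_mem hx, mul_comm]
      exact (mul_le_mul_of_nonneg_right (gaussDensity_le hα x) (power1_nonneg hℓ X x)).trans
        (le_add_of_nonneg_right (mul_nonneg (Real.exp_pos _).le (hT0 x)))
    · rw [Set.indicator_of_notMem hx, zero_add]
      have hx' : (J : ℝ) ≤ |x| := by
        by_contra! h
        exact hx ⟨(abs_lt.1 h).1, (abs_lt.1 h).2.le⟩
      exact (mul_le_of_le_one_left (gaussDensity_nonneg hα x) (power1_le_one hℓ X x)).trans
        (gaussDensity_le_of_le_abs hα hr hx')
  have hind : Integrable (s.indicator fun x => G * power1 ℓ X x) :=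
    (integrable_indicator_iff measurableSet_Ioc).2 hPs
  refine (integral_mono hPg (hind.add (hT.const_mul _)) hle).trans ?_
  simp only [Pi.add_apply]
  rw [integral_add hind (hT.const_mul _), integral_const_mul, integral_indicator measurableSet_Ioc,
    integral_const_mul]
  refine add_le_add_left (mul_le_mul_of_nonneg_left ?_ hG0) _
  have hsum := intervalIntegral.sum_integral_adjacent_intervals (f := power1 ℓ X) (μ := volume)
    (a := fun n : ℕ => -(J : ℝ) + n) (n := 2 * J) fun _ _ => hii _ _
  have hend : -(J : ℝ) + ((2 * J : ℕ) : ℝ) = J := by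
    push_cast
    ring
  simp only [hend, Nat.cast_zero, add_zero] at hsum
  rw [← intervalIntegral.integral_of_le (by linarith [Nat.cast_nonneg (α := ℝ) J]), ← hsum]
  have hcard := Finset.sum_le_card_nsmul (Finset.range (2 * J))
    (fun n : ℕ => ∫ x in (-(J : ℝ) + n)..(-(J : ℝ) + ((n + 1 : ℕ) : ℝ)), power1 ℓ X x) B
    fun n hn => by
      have h1 := hB n (Finset.mem_range.1 hn)
      rw [integral_Icc_eq_integral_Ioc, ← intervalIntegral.integral_of_le (by linarith)] at h1
      push_cast
      rwa [← add_assoc]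
  rw [Finset.card_range, nsmul_eq_mul] at hcard
  push_cast at hcard ⊢
  exact hcard

/-- isotropic product grid version of the optimal-weight worst-case error
bound. -/
theorem stmt17 (d : ℕ) (hd : 0 < d) (α ℓ C h₀ cqu : ℝ) (hα : 0 < α) (hℓ : 0 < ℓ)
    (hC : 0 < C) (hh₀ : h₀ ∈ Set.Ioc (0 : ℝ) 1) (hcqu : 0 < cqu)
    (hsamp : ∀ (a : ℝ) (X : Finset ℝ), (∃ y ∈ X, y ∈ Set.Icc a (a + 1)) →
      fillDist1 X (Set.Icc a (a + 1)) ≤ h₀ →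
      (∫ x in Set.Icc a (a + 1), power1 ℓ X x)
        ≤ Real.exp (C * Real.log (fillDist1 X (Set.Icc a (a + 1))) /
            fillDist1 X (Set.Icc a (a + 1)))) :
    ∃ C' : ℝ, 0 < C' ∧
      ∀ Y : ℕ → Finset ℝ,
        (∀ m, 1 ≤ m → (Y m : Set ℝ) ⊆ Set.Ioo (0 : ℝ) 1 ∧ (Y m).card = m ∧
          fillDist1 (Y m) (Set.Ioo 0 1) ≤ cqu / (m : ℝ)) →
        ∀ k : ℕ, 2 * cqu / min h₀ cqu⁻¹ ≤ (k : ℝ) →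
          eoptD (fun _ : Fin d => α) (fun _ => ℓ)
              (Fintype.piFinset fun _ : Fin d => Xk Y k)
            ≤ C' * Real.exp (-Real.sqrt ((k : ℝ) * ((k : ℝ) + 1)) /
                (2 * Real.sqrt 2 * α ^ 2)) := by
  set B : ℝ := 1 / (2 * Real.sqrt 2 * α ^ 2) with hB
  have hB0 : 0 < B := by positivity
  set G : ℝ := (Real.sqrt (2 * Real.pi) * α)⁻¹ with hG
  have hG0 : 0 < G := by positivity
  set R : ℝ := (B + 1) * (2 * cqu) with hR
  set K : ℝ := Real.exp (C * Real.exp (R / C)) with hK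
  set T : ℝ := ∫ x, G * Real.exp ((2 * B) ^ 2 * α ^ 2) * Real.exp (-(4 * α ^ 2)⁻¹ * x ^ 2) with hT
  have hT0 : 0 ≤ T := integral_nonneg fun x => by positivity
  have hM0 : 0 < G * K + Real.exp B * T :=
    add_pos_of_pos_of_nonneg (mul_pos hG0 (Real.exp_pos _)) (mul_nonneg (Real.exp_pos _).le hT0)
  refine ⟨Real.sqrt d * ((G * K + Real.exp B * T) * Real.exp B), by positivity, fun Y hY k hk => ?_⟩
  have hmin : 0 < min h₀ cqu⁻¹ := lt_min hh₀.1 (inv_pos.2 hcqu)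
  have hk0 : (0 : ℝ) < k := lt_of_lt_of_le (by positivity) hk
  have hδ : 2 * cqu / k ≤ h₀ := by
    rw [div_le_iff₀ hmin] at hk
    rw [div_le_iff₀ hk0, mul_comm h₀]
    exact hk.trans (mul_le_mul_of_nonneg_left (min_le_left _ _) hk0.le)
  have hloc : ∀ n < 2 * (k / 2), ∫ x in Set.Icc (-((k / 2 : ℕ) : ℝ) + n)
      (-((k / 2 : ℕ) : ℝ) + n + 1), power1 ℓ (Xk Y k) x ≤ K * Real.exp (-R * (k / (2 * cqu))) := by
    intro n hn
    obtain ⟨p, hp1, hkp, hpX⟩ := exists_translate_subset_Xk Y hn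
    obtain ⟨hYI, hYc, hYf⟩ := hY p hp1
    have hne : (Y p).Nonempty := Finset.card_pos.1 (by omega)
    have hfill := fillDist1_Icc_le_of_translate (δ := 2 * cqu / k) (by positivity) hne hYI hpX
      (hYf.trans (by
        have hp0 : (0 : ℝ) < p := by exact_mod_cast hp1
        have hkp' : (k : ℝ) ≤ 2 * p := by exact_mod_cast hkp
        rw [div_le_div_iff₀ hp0 hk0]
        nlinarith))
    have hex : ∃ y ∈ Xk Y k, y ∈ Set.Icc (-((k / 2 : ℕ) : ℝ) + n) (-((k / 2 : ℕ) : ℝ) + n + 1) := by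
      obtain ⟨y, hy⟩ := hne
      have hyI := hYI hy
      exact ⟨_, hpX y hy, ⟨by linarith [hyI.1], by linarith [hyI.2]⟩⟩
    refine (hsamp _ _ hex (hfill.trans hδ)).trans
      (exp_log_div_le hC (by positivity) (fillDist1_pos (lt_add_one _) hex) ?_)
    calc _ ≤ 2 * cqu / k * (k / (2 * cqu)) := mul_le_mul_of_nonneg_right hfill (by positivity)
      _ = 1 := by field_simp
  have hint := integral_power1_mul_gaussDensity_le (r := 2 * B) hα hℓ (by positivity) (Xk Y k)
    (k / 2) hloc
  have hJ1 : 2 * ((k / 2 : ℕ) : ℝ) ≤ k := by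
    have : 2 * (k / 2) ≤ k := by omega
    exact_mod_cast this
  have hJ2 : (k : ℝ) ≤ 2 * ((k / 2 : ℕ) : ℝ) + 1 := by
    have : k ≤ 2 * (k / 2) + 1 := by omega
    exact_mod_cast this
  have hE : ∫ x, power1 ℓ (Xk Y k) x * gaussDensity α x
      ≤ (G * K + Real.exp B * T) * Real.exp (-B * k) := by
    refine hint.trans ?_
    have e1 : Real.exp (-R * (k / (2 * cqu))) = Real.exp (-B * k) * Real.exp (-(k : ℝ)) := by
      rw [← Real.exp_add]
      congr 1
      rw [hR]
      field_simp
      ring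
    have e2 : 2 * ((k / 2 : ℕ) : ℝ) * Real.exp (-(k : ℝ)) ≤ 1 := by
      rw [Real.exp_neg, ← div_eq_mul_inv, div_le_one (Real.exp_pos _)]
      linarith [Real.add_one_le_exp (k : ℝ)]
    have e3 : Real.exp (-(2 * B) * ((k / 2 : ℕ) : ℝ)) ≤ Real.exp B * Real.exp (-B * k) := by
      rw [← Real.exp_add, Real.exp_le_exp]
      nlinarith
    rw [e1, add_mul]
    refine add_le_add ?_ ?_
    · calc _ = G * K * Real.exp (-B * k) * (2 * ((k / 2 : ℕ) : ℝ) * Real.exp (-(k : ℝ))) := by ring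
        _ ≤ G * K * Real.exp (-B * k) := mul_le_of_le_one_right (by positivity) e2
    · calc _ ≤ Real.exp B * Real.exp (-B * k) * T := mul_le_mul_of_nonneg_right e3 hT0
        _ = _ := by ring
  refine (eoptD_le_of_integral_power1_le hd hα hℓ (mul_pos hM0 (Real.exp_pos _)) _ hE).trans ?_
  have hsqrt : Real.sqrt ((k : ℝ) * ((k : ℝ) + 1)) ≤ k + 1 := by
    rw [Real.sqrt_le_left (by positivity)]
    nlinarith
  have hexp : Real.exp (-B * k) ≤ Real.exp B *
      Real.exp (-Real.sqrt ((k : ℝ) * ((k : ℝ) + 1)) / (2 * Real.sqrt 2 * α ^ 2)) := by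
    rw [← Real.exp_add, Real.exp_le_exp, div_eq_mul_one_div, ← hB]
    nlinarith
  calc _ ≤ Real.sqrt d * ((G * K + Real.exp B * T) * (Real.exp B *
        Real.exp (-Real.sqrt ((k : ℝ) * ((k : ℝ) + 1)) / (2 * Real.sqrt 2 * α ^ 2)))) := by gcongr
    _ = _ := by ring

end
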